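/- For all integers $K \ge 1$ and all real $r > 0$: $\sum_{k=0}^{K-1} \Big[\frac{1 + \cos(k\pi/K)}{2}\Big]^r \ge \frac{K}{2^{\max\{1, r\}}}$. -/

import Mathlib

open Real Finset

lemma sum_cos_aux (K : ℕ) (hK : 1 ≤ K) :
    ∑ k ∈ range K, Real.cos ((k : ℝ) * π / K) = 1 := by
  have hK0 : (K : ℝ) ≠ 0 := by positivity
  have h1 := Finset.sum_range_reflect (fun k : ℕ => Real.cos ((k : ℝ) * π / K)) (K + 1)
  have h2 : ∑ j ∈ range (K + 1), Real.cos (((K + 1 - 1 - j : ℕ) : ℝ) * π / K)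
      = ∑ j ∈ range (K + 1), - Real.cos ((j : ℝ) * π / K) := by
    apply Finset.sum_congr rfl
    intro j hj
    have hj' : j ≤ K := by
      have := Finset.mem_range.mp hj
      omega
    rw [← Real.cos_pi_sub]
    congr 1
    rw [Nat.add_sub_cancel, Nat.cast_sub hj']
    field_simp
  rw [h2, Finset.sum_neg_distrib, Finset.sum_range_succ] at h1
  have h3 : (K : ℝ) * π / K = π := by field_simp
  rw [h3, Real.cos_pi] at h1
  linarith

/-- Lower bound for sums of powers of cosine step size factors. -/
theorem sum_cos_pow_ge
    (K : ℕ) (hK : 1 ≤ K) (r : ℝ) (hr : 0 < r) :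
    ∑ k ∈ range K, ((1 + Real.cos ((k : ℝ) * π / K)) / 2) ^ r ≥
      (K : ℝ) / 2 ^ (max 1 r) := by
  have hs := sum_cos_aux K hK
  rcases le_total r 1 with h | h
  · rw [max_eq_left h, Real.rpow_one]
    have h1 : ∑ k ∈ range K, ((1 + Real.cos ((k : ℝ) * π / K)) / 2) ≤
        ∑ k ∈ range K, ((1 + Real.cos ((k : ℝ) * π / K)) / 2) ^ r := by
      apply Finset.sum_le_sum
      intro k _
      have ha := Real.neg_one_le_cos ((k : ℝ) * π / K)
      have hb := Real.cos_le_one ((k : ℝ) * π / K)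
      exact Real.self_le_rpow_of_le_one (by linarith) (by linarith) h
    rw [← Finset.sum_div, Finset.sum_add_distrib, hs] at h1
    simp only [Finset.sum_const, Finset.card_range, nsmul_eq_mul, mul_one] at h1
    linarith
  · rw [max_eq_right h]
    have h1 : ∑ k ∈ range K, ((1 + r * Real.cos ((k : ℝ) * π / K)) / 2 ^ r) ≤
        ∑ k ∈ range K, ((1 + Real.cos ((k : ℝ) * π / K)) / 2) ^ r := by
      apply Finset.sum_le_sum
      intro k _
      have ha := Real.neg_one_le_cos ((k : ℝ) * π / K)
      rw [Real.div_rpow (by linarith) (by norm_num)]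
      gcongr
      exact one_add_mul_self_le_rpow_one_add ha h
    rw [← Finset.sum_div, Finset.sum_add_distrib, ← Finset.mul_sum, hs] at h1
    simp only [Finset.sum_const, Finset.card_range, nsmul_eq_mul, mul_one] at h1
    refine le_trans ?_ h1
    gcongr
    linarith
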